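/- For every n ≥ 1, the following identity holds in F, where every complete homogeneous symmetric polynomial h_m below is evaluated at the 2n quantities (u X_1, …, u X_n, v X_1^{−1}, …, v X_n^{−1}): det_{1 ≤ i, j ≤ n}( (u²X_i² + u w X_i)^j − (v²X_i^{−2} + v w X_i^{−1})^j ) / [ ∏_{1 ≤ i < j ≤ n} (X_j − X_i)(v X_i^{−1} X_j^{−1} − u) · ∏_{i=1}^{n} (u X_i − v X_i^{−1}) ] = (1/2) · det_{1 ≤ i, j ≤ n}( Σ_{k=j}^{2j} binom(j, k−j) w^{2j−k} ( h_{k+i−n−1} + u^{i−1} v^{i−1} h_{k−i−n+1} ) ). -/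

import Mathlib

noncomputable section

/-- Complete homogeneous symmetric polynomial of degree `m` evaluated at the list `l`. -/
def hpow {R : Type*} [CommSemiring R] : ℕ → List R → R
  | 0, _ => 1
  | _ + 1, [] => 0
  | m + 1, x :: xs => hpow (m + 1) xs + x * hpow m (x :: xs)
  termination_by m l => m + l.length

/-- `h_m` with integer degree: zero for negative degrees. -/
def hz {R : Type*} [CommSemiring R] (m : ℤ) (l : List R) : R :=
  if m < 0 then 0 else hpow m.toNat l

/-- Elementary symmetric polynomial of degree `m` evaluated at the list `l`;
zero for `m` larger than the length of `l`. -/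
def epow {R : Type*} [CommSemiring R] : ℕ → List R → R
  | 0, _ => 1
  | _ + 1, [] => 0
  | m + 1, x :: xs => epow (m + 1) xs + x * epow m xs

/-- `e_m` with integer degree: zero for negative degrees. -/
def ez {R : Type*} [CommSemiring R] (m : ℤ) (l : List R) : R :=
  if m < 0 then 0 else epow m.toNat l

/-- The field `F = ℚ(u, v, w, X_1, …, X_n)` of rational functions. -/
abbrev Fld (n : ℕ) : Type := FractionRing (MvPolynomial (Fin n ⊕ Fin 3) ℚ)

/-- The indeterminate `u`. -/
def uu (n : ℕ) : Fld n :=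
  algebraMap (MvPolynomial (Fin n ⊕ Fin 3) ℚ) (Fld n) (MvPolynomial.X (Sum.inr 0))

/-- The indeterminate `v`. -/
def vv (n : ℕ) : Fld n :=
  algebraMap (MvPolynomial (Fin n ⊕ Fin 3) ℚ) (Fld n) (MvPolynomial.X (Sum.inr 1))

/-- The indeterminate `w`. -/
def wP (n : ℕ) : Fld n :=
  algebraMap (MvPolynomial (Fin n ⊕ Fin 3) ℚ) (Fld n) (MvPolynomial.X (Sum.inr 2))

/-- The indeterminate `X_i` (here `i : Fin n` corresponds to `X_{i+1}`). -/
def XP {n : ℕ} (i : Fin n) : Fld n :=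
  algebraMap (MvPolynomial (Fin n ⊕ Fin 3) ℚ) (Fld n) (MvPolynomial.X (Sum.inl i))

/-- The `2n` quantities `(u X_1, …, u X_n, v X_1^{−1}, …, v X_n^{−1})`. -/
def bigArgs (n : ℕ) : List (Fld n) :=
  ((List.finRange n).map fun i => uu n * XP i) ++ ((List.finRange n).map fun i => vv n * (XP i)⁻¹)

/-- `h_m(u X_1, …, u X_n, v X_1^{−1}, …, v X_n^{−1})`. -/
def Hn (n : ℕ) (m : ℤ) : Fld n := hz m (bigArgs n)

/-- The recurrence `h_m(x, l) = h_m(l) + x h_{m-1}(x, l)` holds in every integer degree. -/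
theorem hz_cons {R : Type*} [CommSemiring R] (m : ℤ) (x : R) (l : List R) :
    hz m (x :: l) = hz m l + x * hz (m - 1) (x :: l) := by
  rcases lt_trichotomy m 0 with h | rfl | h
  · simp [hz, h, show m - 1 < 0 by omega]
  · simp [hz, hpow]
  · obtain ⟨k, rfl⟩ : ∃ k : ℕ, m = k + 1 := ⟨(m - 1).toNat, by omega⟩
    have h1 : ¬ ((k : ℤ) + 1 < 0) := by omega
    have h2 : ¬ ((k : ℤ) + 1 - 1 < 0) := by omega
    have h3 : ((k : ℤ) + 1).toNat = k + 1 := by omega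
    have h4 : ((k : ℤ) + 1 - 1).toNat = k := by omega
    simp only [hz, h1, h2, h3, h4, if_false]
    rw [hpow]

theorem hz_nil {R : Type*} [CommSemiring R] {m : ℤ} (hm : m ≠ 0) :
    hz m ([] : List R) = 0 := by
  rcases lt_or_gt_of_ne hm with h | h
  · simp [hz, h]
  · obtain ⟨k, rfl⟩ : ∃ k : ℕ, m = k + 1 := ⟨(m - 1).toNat, by omega⟩
    have h1 : ¬ ((k : ℤ) + 1 < 0) := by omega
    have h3 : ((k : ℤ) + 1).toNat = k + 1 := by omega
    simp only [hz, h1, h3, if_false]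
    rw [hpow]

/-- Partial fraction formula for complete homogeneous symmetric polynomials at distinct points. -/
theorem sum_pow_div_prod_sub_eq_hz {K : Type*} [Field K] [DecidableEq K] (p : ℕ) (l : List K)
    (hl : l.Nodup) :
    ∑ y ∈ l.toFinset, y ^ p / ∏ z ∈ l.toFinset.erase y, (y - z) =
      hz ((p : ℤ) + 1 - l.length) l := by
  induction p generalizing l with
  | zero =>
    rcases l with _ | ⟨x, xs⟩
    · rw [hz_nil (by simp)]
      simp
    · have hcard : (x :: xs).toFinset.card = xs.length + 1 := by
        rw [List.toFinset_card_of_nodup hl, List.length_cons]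
      have h := Lagrange.coeff_eq_sum (s := (x :: xs).toFinset) (v := id)
        (Set.injOn_id _) (P := (1 : Polynomial K))
        (by rw [hcard, Polynomial.degree_one]; exact_mod_cast Nat.succ_pos _)
      simp only [id, Polynomial.eval_one] at h
      simp only [pow_zero]
      rw [← h, hcard, Polynomial.coeff_one]
      rcases xs with _ | ⟨x', xs⟩
      · simp [hz, hpow]
      · have : ((0 : ℕ) : ℤ) + 1 - (x :: x' :: xs).length < 0 := by
          simp only [List.length_cons]; push_cast; omega
        rw [hz, if_pos this]
        simp
  | succ p ih =>
    rcases l with _ | ⟨x, xs⟩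
    · rw [hz_nil (by simp; omega)]
      simp
    · have hx : x ∉ xs.toFinset := by simpa using (List.nodup_cons.1 hl).1
      rw [hz_cons]
      have e1 : ((p + 1 : ℕ) : ℤ) + 1 - (x :: xs).length = (p : ℤ) + 1 - xs.length := by
        simp
      have e2 : ((p + 1 : ℕ) : ℤ) + 1 - (x :: xs).length - 1
          = (p : ℤ) + 1 - (x :: xs).length := by
        push_cast; ring
      rw [e2, e1, ← ih _ hl, ← ih _ (List.nodup_cons.1 hl).2, ← sub_eq_iff_eq_add,
        Finset.mul_sum, ← Finset.sum_sub_distrib, List.toFinset_cons, Finset.sum_insert hx]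
      rw [show x ^ (p + 1) / ∏ z ∈ (insert x xs.toFinset).erase x, (x - z) -
        x * (x ^ p / ∏ z ∈ (insert x xs.toFinset).erase x, (x - z)) = 0 by ring, zero_add]
      refine Finset.sum_congr rfl fun y hy => ?_
      have hyx : y ≠ x := fun h => hx (h ▸ hy)
      rw [Finset.erase_insert_of_ne hyx.symm,
        Finset.prod_insert (fun h => hx (Finset.mem_of_mem_erase h))]
      have := sub_ne_zero.2 hyx
      rw [← mul_div_assoc, ← sub_div, pow_succ', ← sub_mul, mul_div_mul_left _ _ this]

/-- The product over ordered pairs of distinct indices, split according to their order. -/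
theorem prod_prod_erase_eq_prod_lt {K : Type*} [CommRing K] {n : ℕ} (g : Fin n → Fin n → K) :
    ∏ i, ∏ l ∈ Finset.univ.erase i, g i l =
      (∏ p ∈ Finset.univ.filter (fun p : Fin n × Fin n => p.1 < p.2), g p.1 p.2) *
      ∏ p ∈ Finset.univ.filter (fun p : Fin n × Fin n => p.1 < p.2), g p.2 p.1 := by
  simp only [Finset.prod_filter, Fintype.prod_prod_type]
  rw [Finset.prod_comm (f := fun x y => if x < y then g y x else 1), ← Finset.prod_mul_distrib]
  refine Finset.prod_congr rfl fun i _ => ?_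
  rw [← Finset.prod_mul_distrib, ← Finset.mul_prod_erase _ _ (Finset.mem_univ i)]
  simp only [lt_irrefl, if_false, one_mul]
  refine Finset.prod_congr rfl fun l hl => ?_
  rcases lt_or_gt_of_ne (Finset.ne_of_mem_erase hl) with h | h <;> simp [h, h.not_gt]

section PairedVariables

variable {K : Type*} [Field K] {n : ℕ} {a b : Fin n → K} {q : K}

theorem prod_sub_mul_prod_sub_eq (hab : ∀ i, a i * b i = q) (i : Fin n) :
    (∏ l ∈ Finset.univ.erase i, (a i - a l)) * ∏ l, (a i - b l) =
      (a i - b i) * a i ^ (n - 1) *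
        ∏ l ∈ Finset.univ.erase i, ((a i + b i) - (a l + b l)) := by
  rw [← Finset.mul_prod_erase _ _ (Finset.mem_univ i), mul_left_comm, ← Finset.prod_mul_distrib,
    mul_assoc]
  have hc : (Finset.univ.erase i).card = n - 1 := by
    simp [Finset.card_erase_of_mem (Finset.mem_univ i)]
  rw [← hc, ← Finset.prod_const, ← Finset.prod_mul_distrib]
  congr 1
  refine Finset.prod_congr rfl fun l _ => ?_
  linear_combination hab l - hab i

/-- Complete homogeneous symmetric polynomials in `2n` variables paired by `a i * b i = q`. -/
theorem hz_paired_eq_sum (hq : q ≠ 0) (hab : ∀ i, a i * b i = q)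
    (hinj : Function.Injective (Sum.elim a b)) {m : ℤ} (hm : 1 - 2 * (n : ℤ) ≤ m) :
    hz m ((List.finRange n).map a ++ (List.finRange n).map b) =
      ∑ i, (a i ^ (m + n) - b i ^ (m + n)) /
        ((a i - b i) * ∏ l ∈ Finset.univ.erase i, ((a i + b i) - (a l + b l))) := by
  classical
  set L := (List.finRange n).map a ++ (List.finRange n).map b with hL
  have ha : ∀ i, a i ≠ 0 := fun i h => hq (by rw [← hab i, h, zero_mul])
  have hb : ∀ i, b i ≠ 0 := fun i h => hq (by rw [← hab i, h, mul_zero])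
  have hnd : L.Nodup := by
    rw [hL, List.nodup_append']
    refine ⟨(List.nodup_finRange n).map (fun i j h => ?_),
      (List.nodup_finRange n).map (fun i j h => ?_), ?_⟩
    · exact Sum.inl_injective (hinj (by simpa using h))
    · exact Sum.inr_injective (hinj (by simpa using h))
    · intro x hx hx'
      simp only [List.mem_map, List.mem_finRange, true_and] at hx hx'
      obtain ⟨i, rfl⟩ := hx
      obtain ⟨j, hj⟩ := hx'
      exact Sum.inr_ne_inl (hinj (a₁ := .inr j) (a₂ := .inl i) (by simpa using hj))
  have hset : L.toFinset = Finset.univ.map ⟨Sum.elim a b, hinj⟩ := by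
    ext y
    simp [hL]
  have hlen : (L.length : ℤ) = 2 * n := by
    simp [hL]; ring
  obtain ⟨p, hp⟩ : ∃ p : ℕ, (p : ℤ) = m + 2 * n - 1 := ⟨(m + 2 * n - 1).toNat, by omega⟩
  have key := sum_pow_div_prod_sub_eq_hz p L hnd
  rw [hlen, hp, show m + 2 * (n : ℤ) - 1 + 1 - 2 * n = m by ring] at key
  rw [← key, hset, Finset.sum_map, Fintype.sum_sum_type, ← Finset.sum_add_distrib]
  refine Finset.sum_congr rfl fun i _ => ?_
  rw [← Finset.map_erase, ← Finset.map_erase, Finset.prod_map, Finset.prod_map]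
  have e1 : Finset.univ.erase (Sum.inl i : Fin n ⊕ Fin n) =
      (Finset.univ.erase i).disjSum Finset.univ := by
    ext (x | x) <;> simp
  have e2 : Finset.univ.erase (Sum.inr i : Fin n ⊕ Fin n) =
      Finset.univ.disjSum (Finset.univ.erase i) := by
    ext (x | x) <;> simp
  rw [e1, e2, Finset.prod_disjSum, Finset.prod_disjSum]
  simp only [Function.Embedding.coeFn_mk, Sum.elim_inl, Sum.elim_inr]
  have hba : ∀ i, b i * a i = q := fun i => by rw [mul_comm, hab]
  rw [prod_sub_mul_prod_sub_eq hab, mul_comm (∏ l, (b i - a l)), prod_sub_mul_prod_sub_eq hba]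
  simp only [add_comm (b _) (a _)]
  have hn : 1 ≤ n := i.pos
  have hsplit : ∀ x : K, x ≠ 0 → x ^ p = x ^ (m + n) * x ^ (n - 1) := by
    intro x hx
    rw [← zpow_natCast, ← zpow_natCast, ← zpow_add₀ hx]
    congr 1
    push_cast [hn]
    omega
  rw [hsplit _ (ha i), hsplit _ (hb i)]
  have h1 := pow_ne_zero (n - 1) (ha i)
  have h2 := pow_ne_zero (n - 1) (hb i)
  rw [mul_right_comm _ (a i ^ (n - 1)), mul_right_comm _ (b i ^ (n - 1)),
    mul_div_mul_right _ _ h1, mul_div_mul_right _ _ h2, ← neg_sub (a i) (b i), neg_mul, div_neg,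
    ← sub_eq_add_neg, ← sub_div]

theorem hz_add_hz_paired_eq_sum (hq : q ≠ 0) (hab : ∀ i, a i * b i = q)
    (hinj : Function.Injective (Sum.elim a b)) {k r : ℕ} (hr : r < n) :
    hz ((k : ℤ) + r - n) ((List.finRange n).map a ++ (List.finRange n).map b) +
      q ^ r * hz ((k : ℤ) - r - n) ((List.finRange n).map a ++ (List.finRange n).map b) =
      ∑ i, (a i ^ r + b i ^ r) * (a i ^ k - b i ^ k) /
        ((a i - b i) * ∏ l ∈ Finset.univ.erase i, ((a i + b i) - (a l + b l))) := by
  rw [hz_paired_eq_sum hq hab hinj (by omega), hz_paired_eq_sum hq hab hinj (by omega),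
    Finset.mul_sum, ← Finset.sum_add_distrib]
  refine Finset.sum_congr rfl fun i _ => ?_
  have ha : a i ≠ 0 := fun h => hq (by rw [← hab i, h, zero_mul])
  have hb : b i ≠ 0 := fun h => hq (by rw [← hab i, h, mul_zero])
  rw [mul_div_assoc', ← add_div]
  congr 1
  simp only [sub_add_cancel]
  rw [zpow_add₀ ha, zpow_add₀ hb, zpow_sub₀ ha, zpow_sub₀ hb]
  simp only [zpow_natCast]
  rw [← hab i]
  field_simp
  ring

/-- Dickson polynomials of the first kind, normalised so that the constant one is `1`. -/
def monicDickson (q : K) (r : ℕ) : Polynomial K :=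
  if r = 0 then 1 else Polynomial.dickson 1 q r

theorem dickson_one_eval_add {x y : K} (hxy : x * y = q) (r : ℕ) :
    (Polynomial.dickson 1 q r).eval (x + y) = x ^ r + y ^ r := by
  induction r using Nat.twoStepInduction with
  | zero => simp; norm_num
  | one => simp
  | more r h0 h1 =>
    rw [Polynomial.dickson_add_two]
    simp only [Polynomial.eval_sub, Polynomial.eval_mul, Polynomial.eval_X, Polynomial.eval_C,
      h0, h1]
    rw [← hxy]
    ring

theorem monicDickson_monic_natDegree (q : K) (r : ℕ) :
    (monicDickson q r).Monic ∧ (monicDickson q r).natDegree = r := by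
  induction r using Nat.twoStepInduction with
  | zero => simp [monicDickson]
  | one => simp [monicDickson]
  | more r h0 h1 =>
    have hX : (Polynomial.X * monicDickson q (r + 1)).Monic := Polynomial.monic_X.mul h1.1
    have hXd : (Polynomial.X * monicDickson q (r + 1)).natDegree = r + 2 := by
      rw [Polynomial.natDegree_X_mul h1.1.ne_zero, h1.2]
    obtain ⟨c, hc⟩ : ∃ c : K, monicDickson q (r + 2) =
        Polynomial.X * monicDickson q (r + 1) - Polynomial.C c * monicDickson q r := by
      rcases r with _ | r
      · refine ⟨2 * q, ?_⟩
        simp [monicDickson, show (Polynomial.C 2 : Polynomial K) = 2 from rfl]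
        ring
      · exact ⟨q, by simp [monicDickson, Polynomial.dickson_add_two]⟩
    have hlt : (Polynomial.C c * monicDickson q r).natDegree <
        (Polynomial.X * monicDickson q (r + 1)).natDegree := by
      rw [hXd]
      refine (Polynomial.natDegree_C_mul_le _ _).trans_lt ?_
      rw [h0.2]
      omega
    rw [hc]
    exact ⟨hX.sub_of_left (Polynomial.degree_lt_degree hlt), by
      rw [Polynomial.natDegree_sub_eq_left_of_natDegree_lt hlt, hXd]⟩

/-- The type `D` Vandermonde determinant. -/
theorem det_pow_add_pow (hn : 1 ≤ n) (hab : ∀ i, a i * b i = q) :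
    (Matrix.of fun i r : Fin n => a i ^ (r : ℕ) + b i ^ (r : ℕ)).det =
      2 * ∏ p ∈ Finset.univ.filter (fun p : Fin n × Fin n => p.1 < p.2),
        ((a p.2 + b p.2) - (a p.1 + b p.1)) := by
  have h := Matrix.det_eval_matrixOfPolynomials_eq_det_vandermonde (fun i => a i + b i)
    (fun r : Fin n => monicDickson q r) (fun r => (monicDickson_monic_natDegree q r).2)
    (fun r => (monicDickson_monic_natDegree q r).1)
  have hv : (Matrix.vandermonde fun i => a i + b i).det =
      ∏ p ∈ Finset.univ.filter (fun p : Fin n × Fin n => p.1 < p.2),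
        ((a p.2 + b p.2) - (a p.1 + b p.1)) := by
    rw [Matrix.det_vandermonde, Finset.prod_filter, Fintype.prod_prod_type]
    refine Finset.prod_congr rfl fun i _ => ?_
    rw [← Finset.prod_filter]
    refine Finset.prod_congr ?_ fun _ _ => rfl
    ext; simp
  have hscale : (Matrix.of fun i r : Fin n => a i ^ (r : ℕ) + b i ^ (r : ℕ)) =
      Matrix.of fun i r : Fin n => (if r = ⟨0, hn⟩ then (2 : K) else 1) *
        (Matrix.of fun i r : Fin n => (monicDickson q r).eval (a i + b i)) i r := by
    ext i r
    simp only [Matrix.of_apply, monicDickson, Fin.ext_iff]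
    split_ifs with hr
    · simp [hr]; norm_num
    · rw [dickson_one_eval_add (hab i), one_mul]
  rw [hscale, Matrix.det_mul_row, ← h, hv,
    Fintype.prod_ite_eq' (⟨0, hn⟩ : Fin n) (fun _ => (2 : K))]

theorem sum_Icc_choose_mul_pow (w x : K) (j : ℕ) :
    ∑ k ∈ Finset.Icc j (2 * j), (Nat.choose j (k - j) : K) * w ^ (2 * j - k) * x ^ k =
      (x ^ 2 + w * x) ^ j := by
  rw [show x ^ 2 + w * x = x * (x + w) by ring, mul_pow, add_pow, Finset.mul_sum,
    ← Finset.Ico_add_one_right_eq_Icc, Finset.sum_Ico_eq_sum_range,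
    show 2 * j + 1 - j = j + 1 by omega]
  refine Finset.sum_congr rfl fun m hm => ?_
  rw [show j + m - j = m by omega, show 2 * j - (j + m) = j - m by omega, pow_add]
  ring

/-- The Jacobi–Trudi identity for variables paired by `a i * b i = q`. -/
theorem det_paired_eq (hn : 1 ≤ n) (hq : q ≠ 0) (hab : ∀ i, a i * b i = q)
    (hinj : Function.Injective (Sum.elim a b)) (h2 : (2 : K) ≠ 0) (w : K) :
    (Matrix.of fun i j : Fin n => (a i ^ 2 + w * a i) ^ ((j : ℕ) + 1) -
          (b i ^ 2 + w * b i) ^ ((j : ℕ) + 1)).det /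
      ((∏ p ∈ Finset.univ.filter (fun p : Fin n × Fin n => p.1 < p.2),
          ((a p.1 + b p.1) - (a p.2 + b p.2))) * ∏ i, (a i - b i)) =
      (1 / 2 : K) *
        (Matrix.of fun i j : Fin n =>
          ∑ k ∈ Finset.Icc ((j : ℕ) + 1) (2 * ((j : ℕ) + 1)),
            (Nat.choose ((j : ℕ) + 1) (k - ((j : ℕ) + 1)) : K) *
              w ^ (2 * ((j : ℕ) + 1) - k) *
              (hz ((k : ℤ) + (i : ℕ) - n) ((List.finRange n).map a ++ (List.finRange n).map b) +
                q ^ (i : ℕ) * hz ((k : ℤ) - (i : ℕ) - n)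
                  ((List.finRange n).map a ++ (List.finRange n).map b))).det := by
  have ha : ∀ i, a i ≠ 0 := fun i h => hq (by rw [← hab i, h, zero_mul])
  have hs : ∀ i j, i ≠ j → (a i + b i) - (a j + b j) ≠ 0 := by
    intro i j hij h
    have h0 : (a i - a j) * (a i - b j) = 0 := by
      linear_combination a i * h + hab j - hab i
    rcases mul_eq_zero.1 h0 with h | h
    · exact hij (Sum.inl_injective (hinj (by simpa using sub_eq_zero.1 h)))
    · exact Sum.inl_ne_inr (hinj (a₁ := .inl i) (a₂ := .inr j) (by simpa using sub_eq_zero.1 h))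
  have hd : ∀ i, a i - b i ≠ 0 := fun i h =>
    Sum.inl_ne_inr (hinj (a₁ := .inl i) (a₂ := .inr i) (by simpa using sub_eq_zero.1 h))
  set N := Matrix.of fun i j : Fin n => (a i ^ 2 + w * a i) ^ ((j : ℕ) + 1) -
          (b i ^ 2 + w * b i) ^ ((j : ℕ) + 1) with hN
  set d : Fin n → K := fun i =>
    (a i - b i) * ∏ l ∈ Finset.univ.erase i, ((a i + b i) - (a l + b l)) with hdef
  have hfac : (Matrix.of fun i j : Fin n =>
          ∑ k ∈ Finset.Icc ((j : ℕ) + 1) (2 * ((j : ℕ) + 1)),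
            (Nat.choose ((j : ℕ) + 1) (k - ((j : ℕ) + 1)) : K) *
              w ^ (2 * ((j : ℕ) + 1) - k) *
              (hz ((k : ℤ) + (i : ℕ) - n) ((List.finRange n).map a ++ (List.finRange n).map b) +
                q ^ (i : ℕ) * hz ((k : ℤ) - (i : ℕ) - n)
                  ((List.finRange n).map a ++ (List.finRange n).map b))) =
      (Matrix.of fun i r : Fin n => (d i)⁻¹ *
        (Matrix.of fun i r : Fin n => a i ^ (r : ℕ) + b i ^ (r : ℕ)) i r).transpose * N := by
    ext r j
    simp only [Matrix.of_apply, Matrix.mul_apply, Matrix.transpose_apply, hN]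
    simp only [hz_add_hz_paired_eq_sum hq hab hinj r.isLt, Finset.mul_sum]
    rw [Finset.sum_comm]
    refine Finset.sum_congr rfl fun i _ => ?_
    rw [← sum_Icc_choose_mul_pow, ← sum_Icc_choose_mul_pow, ← Finset.sum_sub_distrib,
      Finset.mul_sum]
    refine Finset.sum_congr rfl fun k _ => ?_
    rw [div_eq_mul_inv]
    ring
  rw [hfac, Matrix.det_mul, Matrix.det_transpose, Matrix.det_mul_column, det_pow_add_pow hn hab,
    Finset.prod_inv_distrib, hdef, Finset.prod_mul_distrib,
    prod_prod_erase_eq_prod_lt (fun i l => (a i + b i) - (a l + b l))]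
  have p1 : ∏ p ∈ Finset.univ.filter (fun p : Fin n × Fin n => p.1 < p.2),
      ((a p.1 + b p.1) - (a p.2 + b p.2)) ≠ 0 :=
    Finset.prod_ne_zero_iff.2 fun p hp => hs _ _ (Finset.mem_filter.1 hp).2.ne
  have p2 : ∏ p ∈ Finset.univ.filter (fun p : Fin n × Fin n => p.1 < p.2),
      ((a p.2 + b p.2) - (a p.1 + b p.1)) ≠ 0 :=
    Finset.prod_ne_zero_iff.2 fun p hp => hs _ _ (Finset.mem_filter.1 hp).2.ne'
  have p3 : ∏ i, (a i - b i) ≠ 0 := Finset.prod_ne_zero_iff.2 fun i _ => hd i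
  field_simp

end PairedVariables

theorem algebraMap_fld_injective (n : ℕ) :
    Function.Injective (algebraMap (MvPolynomial (Fin n ⊕ Fin 3) ℚ) (Fld n)) :=
  IsFractionRing.injective _ _

theorem XP_ne_zero {n : ℕ} (i : Fin n) : XP i ≠ 0 := by
  rw [XP, Ne, map_eq_zero_iff _ (algebraMap_fld_injective n)]
  exact MvPolynomial.X_ne_zero _

theorem uu_ne_zero (n : ℕ) : uu n ≠ 0 := by
  rw [uu, Ne, map_eq_zero_iff _ (algebraMap_fld_injective n)]
  exact MvPolynomial.X_ne_zero _

theorem vv_ne_zero (n : ℕ) : vv n ≠ 0 := by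
  rw [vv, Ne, map_eq_zero_iff _ (algebraMap_fld_injective n)]
  exact MvPolynomial.X_ne_zero _

theorem XP_injective (n : ℕ) : Function.Injective (XP : Fin n → Fld n) := fun _ _ h =>
  Sum.inl_injective (MvPolynomial.X_injective (algebraMap_fld_injective n h))

theorem uu_mul_XP_mul_XP_ne_vv {n : ℕ} (i j : Fin n) : uu n * XP i * XP j ≠ vv n := by
  simp only [uu, vv, XP, ← map_mul]
  intro h
  have h' := congrArg (MvPolynomial.eval (Sum.elim (fun _ => (1 : ℚ)) ![1, 0, 0]))
    (algebraMap_fld_injective n h)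
  simp at h'

theorem sumElim_bigArgs_injective (n : ℕ) :
    Function.Injective
      (Sum.elim (fun i => uu n * XP i) (fun i : Fin n => vv n * (XP i)⁻¹)) := by
  have hne : ∀ i j : Fin n, uu n * XP i ≠ vv n * (XP j)⁻¹ := fun i j h =>
    uu_mul_XP_mul_XP_ne_vv i j (by rw [h, inv_mul_cancel_right₀ (XP_ne_zero j)])
  refine Function.Injective.sumElim (fun i j h => ?_) (fun i j h => ?_) hne
  · exact XP_injective n (mul_left_cancel₀ (uu_ne_zero n) h)
  · exact XP_injective n (inv_injective (mul_left_cancel₀ (vv_ne_zero n) h))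

/-- **Corollary 5.2 (1).** For `n ≥ 1`, in `ℚ(u,v,w,X_1,…,X_n)`, with all `h`'s evaluated at
`(u X_1, …, u X_n, v X_1^{−1}, …, v X_n^{−1})`:
`det_{1≤i,j≤n}((u²X_i² + uwX_i)^j − (v²X_i^{−2} + vwX_i^{−1})^j)
  / [∏_{1≤i<j≤n}(X_j − X_i)(vX_i^{−1}X_j^{−1} − u) · ∏_{i=1}^n (uX_i − vX_i^{−1})]
 = (1/2) · det_{1≤i,j≤n}(Σ_{k=j}^{2j} binom(j,k−j) w^{2j−k}
     (h_{k+i−n−1} + u^{i−1}v^{i−1} h_{k−i−n+1}))`. -/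
theorem det_sub_quotient_eq_jacobiTrudi (n : ℕ) (hn : 1 ≤ n) :
    (Matrix.of fun i j : Fin n =>
          ((uu n) ^ 2 * (XP i) ^ 2 + uu n * wP n * XP i) ^ ((j : ℕ) + 1) -
            ((vv n) ^ 2 * ((XP i)⁻¹) ^ 2 + vv n * wP n * (XP i)⁻¹) ^ ((j : ℕ) + 1)).det /
      ((∏ p ∈ Finset.univ.filter (fun p : Fin n × Fin n => p.1 < p.2),
          ((XP p.2 - XP p.1) * (vv n * (XP p.1)⁻¹ * (XP p.2)⁻¹ - uu n))) *
        ∏ i : Fin n, (uu n * XP i - vv n * (XP i)⁻¹)) =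
      (1 / 2 : Fld n) *
        (Matrix.of fun i j : Fin n =>
          ∑ k ∈ Finset.Icc ((j : ℕ) + 1) (2 * ((j : ℕ) + 1)),
            (Nat.choose ((j : ℕ) + 1) (k - ((j : ℕ) + 1)) : Fld n) *
              wP n ^ (2 * ((j : ℕ) + 1) - k) *
              (Hn n ((k : ℤ) + ((i : ℕ) + 1) - (n : ℤ) - 1) +
                uu n ^ (i : ℕ) * vv n ^ (i : ℕ) *
                  Hn n ((k : ℤ) - ((i : ℕ) + 1) - (n : ℤ) + 1))).det := by
  have hu := uu_ne_zero n
  have hv := vv_ne_zero n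
  have hX : ∀ i : Fin n, XP i ≠ 0 := XP_ne_zero
  have h := det_paired_eq (a := fun i => uu n * XP i) (b := fun i : Fin n => vv n * (XP i)⁻¹)
    hn (mul_ne_zero hu hv) (fun i => by have := hX i; field_simp) (sumElim_bigArgs_injective n)
    two_ne_zero (wP n)
  convert h using 2
  · congr 1
    ext i j
    simp only [Matrix.of_apply]
    ring
  · congr 1
    refine Finset.prod_congr rfl fun p _ => ?_
    have h1 := hX p.1
    have h2 := hX p.2
    field_simp
    ring
  · congr 1
    ext i j
    simp only [Matrix.of_apply, Hn, bigArgs, mul_pow]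
    refine Finset.sum_congr rfl fun k _ => ?_
    rw [show (k : ℤ) + ((i : ℕ) + 1) - n - 1 = k + (i : ℕ) - n by ring,
      show (k : ℤ) - ((i : ℕ) + 1) - n + 1 = k - (i : ℕ) - n by ring]

end
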